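/- arXiv:2104.05288 — 2 statements merged into one kernel-verified Lean document; each statement's English description precedes it below -/
import Mathlib

section
/- In the network G constructed from an X3C instance, every feasible integer almost-equal flow f (with constant deviation Δ(x)=x+1) satisfies val(f) ≤ 7q/3. -/
/-- An instance of Exact-3-Cover: a ground set `Fin q` and a family of `q`
three-element subsets. -/
structure X3C (q : ℕ) where
  sets : Fin q → Finset (Fin q)
  card3 : ∀ i, (sets i).card = 3

/-- A solution of X3C: `q/3` pairwise disjoint sets of the family covering the ground set. -/
def X3C.HasSolution {q : ℕ} (I : X3C q) : Prop :=
  ∃ T : Finset (Fin q),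
    T.card = q / 3 ∧
    (∀ i ∈ T, ∀ i' ∈ T, i ≠ i' → Disjoint (I.sets i) (I.sets i')) ∧
    T.biUnion I.sets = Finset.univ

/-- An integer almost-equal flow (constant deviation `Δ(x) = x + 1`) in the network `G`
associated to an X3C instance: `fs i` is the flow on the edge `(s, S_i)` (capacity 5),
`fb i` the flow on the bonus edge `(S_i, t)` (capacity 2), `fm i j` the flow on the
edge `(S_i, a_j)` (present with capacity 1 iff `a_j ∈ S_i`), and `fa j` the flow on the
edge `(a_j, t)` (capacity 1).  The homologous edge sets are
`R_i = {(S_i,a_j) : a_j ∈ S_i} ∪ {(S_i,t)}` and `R_0 = {(a_j,t) : j}`; requiring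
`f e ≤ (min_{e' ∈ R} f e') + 1` for all `e ∈ R` is expressed equivalently as
`f e ≤ f e' + 1` for all `e, e' ∈ R`. -/
structure IntAEFlow {q : ℕ} (I : X3C q) where
  fs : Fin q → ℤ
  fb : Fin q → ℤ
  fm : Fin q → Fin q → ℤ
  fa : Fin q → ℤ
  fs_nonneg : ∀ i, 0 ≤ fs i
  fs_le : ∀ i, fs i ≤ 5
  fb_nonneg : ∀ i, 0 ≤ fb i
  fb_le : ∀ i, fb i ≤ 2
  fm_nonneg : ∀ i j, 0 ≤ fm i j
  fm_le : ∀ i j, fm i j ≤ 1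
  fm_not_mem : ∀ i j, j ∉ I.sets i → fm i j = 0
  fa_nonneg : ∀ j, 0 ≤ fa j
  fa_le : ∀ j, fa j ≤ 1
  consS : ∀ i, fs i = (∑ j ∈ I.sets i, fm i j) + fb i
  consA : ∀ j, (∑ i, fm i j) = fa j
  hom_mm : ∀ i, ∀ j ∈ I.sets i, ∀ j' ∈ I.sets i, fm i j ≤ fm i j' + 1
  hom_mb : ∀ i, ∀ j ∈ I.sets i, fm i j ≤ fb i + 1
  hom_bm : ∀ i, ∀ j ∈ I.sets i, fb i ≤ fm i j + 1
  hom_a : ∀ j j', fa j ≤ fa j' + 1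

/-- The value of the flow: the net flow into the sink `t`. -/
def IntAEFlow.val {q : ℕ} {I : X3C q} (f : IntAEFlow I) : ℤ :=
  (∑ i, f.fb i) + (∑ j, f.fa j)

theorem IntAEFlow.three_mul_fb_le {q : ℕ} {I : X3C q} (f : IntAEFlow I) (i : Fin q) :
    3 * f.fb i ≤ (∑ j, f.fm i j) + 3 := by
  have h : ∑ _j ∈ I.sets i, f.fb i ≤ ∑ j ∈ I.sets i, (f.fm i j + 1) :=
    Finset.sum_le_sum fun j hj => f.hom_bm i j hj
  rw [Finset.sum_add_distrib, Finset.sum_const, Finset.sum_const, I.card3,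
    Finset.sum_subset (Finset.subset_univ _) fun j _ hj => f.fm_not_mem i j hj] at h
  simpa using h

theorem IntAEFlow.sum_fa_le {q : ℕ} {I : X3C q} (f : IntAEFlow I) :
    ∑ j, f.fa j ≤ (q : ℤ) := by
  simpa using Finset.sum_le_sum fun j (_ : j ∈ Finset.univ) => f.fa_le j

/-- Every feasible integer almost-equal flow in the network constructed from an
X3C instance has value at most `7q/3`. -/
theorem int_ae_flow_value_le
    (q : ℕ) (hq : 3 ∣ q) (I : X3C q) (f : IntAEFlow I) :
    f.val ≤ 7 * (q : ℤ) / 3 := by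
  have hb : 3 * ∑ i, f.fb i ≤ (∑ j, f.fa j) + 3 * (q : ℤ) := by
    have h := Finset.sum_le_sum fun i (_ : i ∈ Finset.univ) => f.three_mul_fb_le i
    rw [← Finset.mul_sum, Finset.sum_add_distrib, Finset.sum_comm] at h
    simp only [f.consA, Finset.sum_const, Finset.card_univ, Fintype.card_fin,
      nsmul_eq_mul] at h
    linarith
  have ha := f.sum_fa_le
  unfold IntAEFlow.val
  omega
end

section
/- If the X3C instance has no solution, then in the extended network G' whose homologous set R_b carries the deviation function Δ_b(x) = kx (and all other homologous sets the deviation Δ(x) = x + 1), every feasible integer almost-equal s-t''-flow has value 0. -/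
/-- An integer almost-equal `s`-`t''`-flow in the extended network `G'` obtained from
the network `G` of an X3C instance by adding nodes `t'`, `t''`, one edge `(t,t')` of
capacity `7q/3`, `7q/3` parallel edges `(t',t'')` of capacity 1, and `k` parallel
bonus edges `(s,t'')` of capacity 2.  Fields: `fs i` is the flow on `(s,S_i)` (cap. 5),
`fb i` on the edge `(S_i,t)` (cap. 2), `fm i j` on `(S_i,a_j)` (cap. 1, present iff
`a_j ∈ S_i`), `fa j` on `(a_j,t)` (cap. 1), `ft` on `(t,t')`, `fp p` on the `p`-th
parallel edge `(t',t'')`, and `fc b` on the `b`-th bonus edge `(s,t'')`.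
The homologous sets `R_1,…,R_q,R_0` and the additional set `R_b` (all edges `(t',t'')`
together with all bonus edges `(s,t'')`) carry the deviations `Δ(x) = x + 1` (for `R_0,…,R_q`) and `Δ_b(x) = k·x` (for `R_b`), expressed
equivalently pairwise within each homologous set. -/
structure ExtIntAEFlowK {q : ℕ} (I : X3C q) (k : ℕ) where
  fs : Fin q → ℤ
  fb : Fin q → ℤ
  fm : Fin q → Fin q → ℤ
  fa : Fin q → ℤ
  ft : ℤ
  fp : Fin (7 * q / 3) → ℤ
  fc : Fin k → ℤ
  fs_nonneg : ∀ i, 0 ≤ fs i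
  fs_le : ∀ i, fs i ≤ 5
  fb_nonneg : ∀ i, 0 ≤ fb i
  fb_le : ∀ i, fb i ≤ 2
  fm_nonneg : ∀ i j, 0 ≤ fm i j
  fm_le : ∀ i j, fm i j ≤ 1
  fm_not_mem : ∀ i j, j ∉ I.sets i → fm i j = 0
  fa_nonneg : ∀ j, 0 ≤ fa j
  fa_le : ∀ j, fa j ≤ 1
  ft_nonneg : 0 ≤ ft
  ft_le : ft ≤ 7 * (q : ℤ) / 3
  fp_nonneg : ∀ p, 0 ≤ fp p
  fp_le : ∀ p, fp p ≤ 1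
  fc_nonneg : ∀ b, 0 ≤ fc b
  fc_le : ∀ b, fc b ≤ 2
  consS : ∀ i, fs i = (∑ j ∈ I.sets i, fm i j) + fb i
  consA : ∀ j, (∑ i, fm i j) = fa j
  consT : (∑ i, fb i) + (∑ j, fa j) = ft
  consT' : ft = ∑ p, fp p
  hom_mm : ∀ i, ∀ j ∈ I.sets i, ∀ j' ∈ I.sets i, fm i j ≤ fm i j' + 1
  hom_mb : ∀ i, ∀ j ∈ I.sets i, fm i j ≤ fb i + 1
  hom_bm : ∀ i, ∀ j ∈ I.sets i, fb i ≤ fm i j + 1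
  hom_a : ∀ j j', fa j ≤ fa j' + 1
  hom_pp : ∀ p p', fp p ≤ (k : ℤ) * fp p'
  hom_pc : ∀ p b, fp p ≤ (k : ℤ) * fc b
  hom_cp : ∀ b p, fc b ≤ (k : ℤ) * fp p
  hom_cc : ∀ b b', fc b ≤ (k : ℤ) * fc b'

/-- The value of the flow: the net flow into the sink `t''`. -/
def ExtIntAEFlowK.val {q : ℕ} {I : X3C q} {k : ℕ} (f : ExtIntAEFlowK I k) : ℤ :=
  (∑ p, f.fp p) + (∑ b, f.fc b)

/-- A flow of nonzero value saturates every parallel edge into the sink. -/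
lemma ExtIntAEFlowK.fp_eq_one_of_val_ne_zero {q : ℕ} {I : X3C q} {k : ℕ}
    (f : ExtIntAEFlowK I k) (h : f.val ≠ 0) (p : Fin (7 * q / 3)) : f.fp p = 1 := by
  have key : f.fp p ≠ 0 := by
    intro h0
    apply h
    have hp : ∀ p', f.fp p' = 0 := fun p' =>
      le_antisymm (by simpa [h0] using f.hom_pp p' p) (f.fp_nonneg p')
    have hc : ∀ b, f.fc b = 0 := fun b =>
      le_antisymm (by simpa [h0] using f.hom_cp b p) (f.fc_nonneg b)
    simp [ExtIntAEFlowK.val, hp, hc]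
  have h1 := f.fp_nonneg p
  have h2 := f.fp_le p
  omega

/-- The indices whose edge `(S_i,t)` carries two units of flow select pairwise disjoint sets. -/
lemma ExtIntAEFlowK.disjoint_of_fb_eq_two {q : ℕ} {I : X3C q} {k : ℕ}
    (f : ExtIntAEFlowK I k) {i i' : Fin q} (hi : f.fb i = 2) (hi' : f.fb i' = 2)
    (hne : i ≠ i') : Disjoint (I.sets i) (I.sets i') := by
  rw [Finset.disjoint_left]
  intro j hj hj'
  have h1 := f.hom_bm i j hj
  have h2 := f.hom_bm i' j hj'
  have h3 := Finset.sum_le_sum_of_subset_of_nonneg (Finset.subset_univ {i, i'})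
    (fun x _ _ => f.fm_nonneg x j)
  rw [Finset.sum_pair hne, f.consA j] at h3
  have h4 := f.fa_le j
  omega

/-- An X3C instance whose network has a flow saturating every parallel edge into the sink has a
solution. -/
lemma ExtIntAEFlowK.hasSolution_of_ft_eq {q : ℕ} (hq : 3 ∣ q) {I : X3C q} {k : ℕ}
    (f : ExtIntAEFlowK I k) (h : f.ft = ((7 * q / 3 : ℕ) : ℤ)) : I.HasSolution := by
  set T : Finset (Fin q) := Finset.univ.filter fun i => f.fb i = 2 with hT
  have hmem : ∀ i, i ∈ T ↔ f.fb i = 2 := by simp [hT]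
  have hdisj : ∀ i ∈ T, ∀ i' ∈ T, i ≠ i' → Disjoint (I.sets i) (I.sets i') :=
    fun i hi i' hi' => f.disjoint_of_fb_eq_two ((hmem i).1 hi) ((hmem i').1 hi')
  have hcard : (T.biUnion I.sets).card = T.card * 3 := by
    rw [Finset.card_biUnion hdisj, Finset.sum_const_nat fun i _ => I.card3 i]
  have hle : (T.biUnion I.sets).card ≤ q := by simpa using Finset.card_le_univ (T.biUnion I.sets)
  have hfa : ∑ j, f.fa j ≤ q := by
    simpa using Finset.sum_le_sum fun j (_ : j ∈ Finset.univ) => f.fa_le j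
  have hfb : ∑ i, f.fb i ≤ q + T.card := by
    calc ∑ i, f.fb i ≤ ∑ i, (1 + if f.fb i = 2 then 1 else 0) := by
          refine Finset.sum_le_sum fun i _ => ?_
          have := f.fb_le i
          split_ifs <;> omega
      _ = q + T.card := by simp [Finset.sum_add_distrib, hT]
  have hcons := f.consT
  refine ⟨T, by omega, hdisj, ?_⟩
  rw [← Finset.card_eq_iff_eq_univ, Fintype.card_fin]
  omega

/-- If the X3C instance has no solution, then in the extended network whose homologous
set `R_b` carries the deviation `Δ_b(x) = k·x` (all other homologous sets carrying
`Δ(x) = x + 1`), every feasible integer almost-equal `s`-`t''`-flow has value `0`. -/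
theorem ext_flow_value_zero_of_no_x3c_solution
    (q : ℕ) (hq : 3 ∣ q) (I : X3C q) (k : ℕ) (hk : 1 ≤ k)
    (hno : ¬ I.HasSolution) (f : ExtIntAEFlowK I k) :
    f.val = 0 := by
  by_contra h
  refine hno (f.hasSolution_of_ft_eq hq ?_)
  simp [f.consT', f.fp_eq_one_of_val_ne_zero h]
end
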